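/- Let μ be a singular cardinal. Suppose there is a scale (⟨μ_i : i < cf(μ)⟩, ⟨f_α : α < μ⁺⟩) for μ such that for every i < cf(μ), the relation μ_i ↛ [(μ_i : μ_i)]²_{μ_i} holds. Then pr₁(μ⁺, μ⁺, μ⁺, cf(μ)) holds. -/

import Mathlib

noncomputable section

open Set

/-- The successor cardinal of `mu`, as an ordinal. -/
def sucOrd (mu : Cardinal) : Ordinal := (Order.succ mu).ord

/-- The cofinality of `mu`, as an ordinal. -/
def cofOrd (mu : Cardinal) : Ordinal := (Ordinal.cof mu.ord).ord

/-- `mu` is a singular cardinal: infinite, with cofinality smaller than itself. -/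
def IsSingular (mu : Cardinal) : Prop :=
  Cardinal.aleph0 ≤ mu ∧ Ordinal.cof mu.ord < mu

/-- `C` is unbounded below `lam`. -/
def UnbddIn (C : Set Ordinal) (lam : Ordinal) : Prop :=
  ∀ x < lam, ∃ y ∈ C, x ≤ y ∧ y < lam

/-- `C` is closed below `lam`: any accumulation point below `lam` belongs to `C`. -/
def ClosedIn (C : Set Ordinal) (lam : Ordinal) : Prop :=
  ∀ δ, δ < lam → 0 < δ → (∀ x < δ, ∃ y ∈ C, x < y ∧ y < δ) → δ ∈ C

/-- `C` is a closed unbounded subset of `lam`. -/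
def IsClubIn (C : Set Ordinal) (lam : Ordinal) : Prop :=
  C ⊆ Set.Iio lam ∧ ClosedIn C lam ∧ UnbddIn C lam

/-- `S` is a stationary subset of `lam`: it meets every closed unbounded subset of `lam`. -/
def IsStatIn (S : Set Ordinal) (lam : Ordinal) : Prop :=
  S ⊆ Set.Iio lam ∧ ∀ C, IsClubIn C lam → (S ∩ C).Nonempty

/-- The set of ordinals `t` has cardinality `< kappa`. -/
def CardLT (t : Set Ordinal) (kappa : Cardinal) : Prop :=
  (Cardinal.mk ↥t : Cardinal.{1}) < Cardinal.lift.{1, 0} kappa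

/-- `c` witnesses Shelah's principle `pr₁(μ⁺, μ⁺, σ, cf μ)`: for every sequence
`⟨t_α : α < μ⁺⟩` of pairwise disjoint subsets of `μ⁺`, each of size `< cf μ`, and every
color `ε < σ`, there are `α < β < μ⁺` with `c` constantly `ε` on pairs from `t_α × t_β`. -/
def Pr1With (mu sigma : Cardinal) (c : Ordinal → Ordinal → Ordinal) : Prop :=
  (∀ a b, a < b → b < sucOrd mu → c a b < sigma.ord) ∧
  ∀ t : Ordinal → Set Ordinal,
    (∀ a, a < sucOrd mu → t a ⊆ Set.Iio (sucOrd mu)) →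
    (∀ a b, a < sucOrd mu → b < sucOrd mu → a ≠ b → Disjoint (t a) (t b)) →
    (∀ a, a < sucOrd mu → CardLT (t a) (Ordinal.cof mu.ord)) →
    ∀ ε, ε < sigma.ord →
      ∃ α β, α < β ∧ β < sucOrd mu ∧
        ∀ ξ ∈ t α, ∀ ζ ∈ t β, c (min ξ ζ) (max ξ ζ) = ε

/-- Shelah's principle `pr₁(μ⁺, μ⁺, σ, cf μ)`. -/
def Pr1 (mu sigma : Cardinal) : Prop := ∃ c, Pr1With mu sigma c

/-- `(mus, f)` is a scale for the singular cardinal `mu`. -/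
structure IsScale (mu : Cardinal) (mus : Ordinal → Cardinal)
    (f : Ordinal → Ordinal → Ordinal) : Prop where
  regular : ∀ i, i < cofOrd mu → (mus i).IsRegular
  strictMono : ∀ i j, i < j → j < cofOrd mu → mus i < mus j
  le_mu : ∀ i, i < cofOrd mu → mus i ≤ mu
  unbdd : ∀ θ, θ < mu → ∃ i, i < cofOrd mu ∧ θ < mus i
  cof_lt : Ordinal.cof mu.ord < mus 0
  f_lt : ∀ α, α < sucOrd mu → ∀ i, i < cofOrd mu → f α i < (mus i).ord
  f_mono : ∀ α β, α < β → β < sucOrd mu →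
    ∃ i0, i0 < cofOrd mu ∧ ∀ i, i0 ≤ i → i < cofOrd mu → f α i < f β i
  f_cofinal : ∀ g : Ordinal → Ordinal, (∀ i, i < cofOrd mu → g i < (mus i).ord) →
    ∃ α, α < sucOrd mu ∧ ∃ i0, i0 < cofOrd mu ∧ ∀ i, i0 ≤ i → i < cofOrd mu → g i < f α i

/-- The minimal walk from `b` down to `a` along the C-sequence `e`:
`walk e a b 0 = b` and `walk e a b (n+1) = min (e (walk e a b n) \ a)`,
staying at `a` once it is reached. -/
def walk (e : Ordinal → Set Ordinal) (a b : Ordinal) : ℕ → Ordinal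
  | 0 => b
  | n + 1 => if walk e a b n = a then a else sInf (e (walk e a b n) ∩ Set.Ici a)

/-- `ρ₂(a,b)`: the length of the minimal walk from `b` to `a`, i.e. the least `n`
with `walk e a b n = a`. -/
def rho2 (e : Ordinal → Set Ordinal) (a b : Ordinal) : ℕ :=
  sInf {n : ℕ | walk e a b n = a}

/-- `β_i⁻(a,b)`: zero for `i = 0`, and `sup (e_{β_j(a,b)} ∩ a)` for `i = j+1`. -/
def walkLow (e : Ordinal → Set Ordinal) (a b : Ordinal) : ℕ → Ordinal
  | 0 => 0
  | j + 1 => sSup (e (walk e a b j) ∩ Set.Iio a)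

/-- `γ(a,b) = β_{ρ₂(a,b)-1}(a,b)`, the last step before the walk reaches `a`. -/
def gammaW (e : Ordinal → Set Ordinal) (a b : Ordinal) : Ordinal :=
  walk e a b (rho2 e a b - 1)

/-- `γ⁻(a,b) = max {β_i⁻(a,b) : i < ρ₂(a,b)}`. -/
def gammaMinusW (e : Ordinal → Set Ordinal) (a b : Ordinal) : Ordinal :=
  sSup (walkLow e a b '' {i : ℕ | i < rho2 e a b})

/-- `η(a,b) = max {β_i⁻(a,b) : i ≤ ρ₂(a,b)}`. -/
def etaW (e : Ordinal → Set Ordinal) (a b : Ordinal) : Ordinal :=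
  sSup (walkLow e a b '' {i : ℕ | i ≤ rho2 e a b})

/-- `e` is a C-sequence on `lam`: each `e ξ` is closed unbounded in `ξ`. -/
def IsCSeq (e : Ordinal → Set Ordinal) (lam : Ordinal) : Prop :=
  ∀ ξ, ξ < lam → IsClubIn (e ξ) ξ

/-- `ξ` is an accumulation point of `C`: `ξ = sup (C ∩ ξ) > 0`. -/
def IsAccOf (C : Set Ordinal) (ξ : Ordinal) : Prop :=
  0 < ξ ∧ sSup (C ∩ Set.Iio ξ) = ξ

/-- The non-accumulation points of `C`. -/
def naccOf (C : Set Ordinal) : Set Ordinal :=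
  {ξ ∈ C | sSup (C ∩ Set.Iio ξ) < ξ}


/-- The relation `θ ↛ [(θ : θ)]²_θ`: there is a coloring of pairs from `θ` with `θ` colors
realizing every color on `{α, β}` with `α ∈ A`, `β ∈ B`, `α ≠ β`, for all unbounded `A, B ⊆ θ`. -/
def SquareBrColon (theta : Cardinal) : Prop :=
  ∃ d : Ordinal → Ordinal → Ordinal,
    (∀ a b, a < b → b < theta.ord → d a b < theta.ord) ∧
    ∀ A B : Set Ordinal, A ⊆ Set.Iio theta.ord → B ⊆ Set.Iio theta.ord →
      UnbddIn A theta.ord → UnbddIn B theta.ord →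
      ∀ ς, ς < theta.ord → ∃ α ∈ A, ∃ β ∈ B, α ≠ β ∧ d (min α β) (max α β) = ς

theorem exists_bound_of_lt_cof {X : Type 1} {o : Ordinal.{0}} {S : Set X} {h : X → Ordinal.{0}}
    (hS : Cardinal.mk S < Cardinal.lift.{1} o.cof) (hh : ∀ a ∈ S, h a < o) :
    ∃ B < o, ∀ a ∈ S, h a < B := by
  refine ⟨sSup ((· + 1) '' (h '' S)), Ordinal.sSup_add_one_lt_of_lt_cof ?_ ?_, ?_⟩
  · rw [← Ordinal.lift_cof]
    exact Cardinal.mk_image_le.trans_lt hS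
  · rintro _ ⟨a, ha, rfl⟩
    exact hh a ha
  · intro a ha
    refine (lt_add_one (h a)).trans_le (le_csSup ⟨o, ?_⟩ ⟨h a, ⟨a, ha, rfl⟩, rfl⟩)
    rintro _ ⟨_, ⟨x, hx, rfl⟩, rfl⟩
    exact Order.add_one_le_of_lt (hh x hx)

theorem exists_bound_of_regular {X : Type 1} {c : Cardinal.{0}} (hc : c.IsRegular) {S : Set X}
    {h : X → Ordinal.{0}} (hS : Cardinal.mk S < Cardinal.lift.{1} c)
    (hh : ∀ a ∈ S, h a < c.ord) : ∃ B < c.ord, ∀ a ∈ S, h a < B :=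
  exists_bound_of_lt_cof (by rwa [hc.cof_ord]) hh

theorem exists_bound_Iio {c : Cardinal.{0}} (hc : c.IsRegular) {x : Ordinal.{0}} (hx : x < c.ord)
    {h : Ordinal.{0} → Ordinal.{0}} (hh : ∀ a < x, h a < c.ord) :
    ∃ B < c.ord, ∀ a < x, h a < B :=
  exists_bound_of_regular (S := Set.Iio x) hc
    (by rw [Cardinal.mk_Iio_ordinal]; exact Cardinal.lift_lt.2 (Cardinal.lt_ord.1 hx)) hh

theorem exists_recursion {X : Type*} (G : Set X → X) :
    ∃ F : Ordinal.{0} → X, ∀ n, F n = G (F '' Set.Iio n) := by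
  refine ⟨WellFounded.fix (wellFounded_lt (α := Ordinal.{0}))
    (fun n ih => G {x | ∃ m, ∃ h : m < n, ih m h = x}), fun n => ?_⟩
  rw [WellFounded.fix_eq]
  congr 1
  ext x
  simp

/-- `α` is closed under `b`. -/
def ClosedPt (b : Ordinal.{0} → Ordinal.{0}) (α : Ordinal.{0}) : Prop := ∀ η < α, b η < α

/-- The largest `b`-closed ordinal that is at most `x`. -/
def lastClosed (b : Ordinal.{0} → Ordinal.{0}) (x : Ordinal.{0}) : Ordinal.{0} :=
  sSup {y | y ≤ x ∧ ClosedPt b y}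

theorem lastClosed_le (b : Ordinal.{0} → Ordinal.{0}) (x : Ordinal.{0}) : lastClosed b x ≤ x :=
  csSup_le' fun _ hy => hy.1

theorem le_lastClosed {b : Ordinal.{0} → Ordinal.{0}} {x y : Ordinal.{0}} (h : y ≤ x)
    (hy : ClosedPt b y) : y ≤ lastClosed b x :=
  le_csSup ⟨x, fun _ hz => hz.1⟩ ⟨h, hy⟩

theorem closedPt_lastClosed (b : Ordinal.{0} → Ordinal.{0}) (x : Ordinal.{0}) :
    ClosedPt b (lastClosed b x) := by
  intro η hη
  obtain ⟨y, hy, hηy⟩ := exists_lt_of_lt_csSup' hη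
  exact (hy.2 η hηy).trans_le (le_lastClosed hy.1 hy.2)

theorem exists_closedPt_cof {c σ : Cardinal.{0}} (hc : c.IsRegular) (hσ : σ.IsRegular)
    (hσc : σ < c) {b : Ordinal.{0} → Ordinal.{0}} (hb : ∀ x < c.ord, b x < c.ord) :
    ∃ ξ < c.ord, ClosedPt b ξ ∧ ξ.cof = σ := by
  have hlim : ∀ x < c.ord, x + 1 < c.ord := fun x hx =>
    (Cardinal.isSuccLimit_ord hc.aleph0_le).succ_lt hx
  have step : ∀ S : Set Ordinal.{0}, ∃ x, (∀ s ∈ S, s < c.ord) →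
      Cardinal.mk S < Cardinal.lift.{1} c →
        x < c.ord ∧ ∀ s ∈ S, s < x ∧ ∀ η ≤ s, b η < x := by
    intro S
    by_cases hS : (∀ s ∈ S, s < c.ord) ∧ Cardinal.mk S < Cardinal.lift.{1} c
    · have : ∀ s, ∃ y, s ∈ S → y < c.ord ∧ s < y ∧ ∀ η ≤ s, b η < y := by
        intro s
        by_cases hs : s ∈ S
        · have hs' := hlim s (hS.1 s hs)
          obtain ⟨y, hy, hby⟩ := exists_bound_Iio hc hs'
            (fun a ha => hb a (ha.trans hs'))
          exact ⟨max y (s + 1), fun _ => ⟨max_lt hy hs', lt_max_of_lt_right (lt_add_one s),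
            fun η hη => lt_max_of_lt_left (hby η (Order.lt_add_one_iff.2 hη))⟩⟩
        · exact ⟨0, fun h => absurd h hs⟩
      choose y hy using this
      obtain ⟨B, hB, hyB⟩ := exists_bound_of_regular hc hS.2 (fun s hs => (hy s hs).1)
      exact ⟨B, fun _ _ => ⟨hB, fun s hs => ⟨(hy s hs).2.1.trans (hyB s hs),
        fun η hη => ((hy s hs).2.2 η hη).trans (hyB s hs)⟩⟩⟩
    · exact ⟨0, fun h1 h2 => absurd ⟨h1, h2⟩ hS⟩
  choose G hG using step
  obtain ⟨F, hF⟩ := exists_recursion G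
  have hlt : ∀ n < σ.ord, F n < c.ord ∧ ∀ m < n, F m < F n ∧ ∀ η ≤ F m, b η < F n := by
    intro n
    induction n using WellFoundedLT.induction with
    | ind n ih =>
      intro hn
      have h := hG (F '' Set.Iio n) (by
          rintro _ ⟨m, hm, rfl⟩
          exact (ih m hm (lt_trans hm hn)).1)
        (Cardinal.mk_image_le.trans_lt (by
          rw [Cardinal.mk_Iio_ordinal]
          exact Cardinal.lift_lt.2 ((Cardinal.lt_ord.1 hn).trans hσc)))
      rw [← hF] at h
      exact ⟨h.1, fun m hm => h.2 _ ⟨m, hm, rfl⟩⟩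
  have hmono : StrictMono (fun n : Set.Iio σ.ord => F n) := fun m n hmn => ((hlt n n.2).2 m hmn).1
  have hlt_iff : ∀ η, η < (⨆ n : Set.Iio σ.ord, F n + 1) ↔ ∃ n < σ.ord, η ≤ F n := by
    intro η
    rw [Ordinal.lt_iSup_add_one_iff]
    simp
  refine ⟨⨆ n : Set.Iio σ.ord, F n + 1, ?_, ?_, ?_⟩
  · obtain ⟨B, hB, hFB⟩ := exists_bound_Iio hc (Cardinal.ord_lt_ord.2 hσc)
      (fun n hn => (hlt n hn).1)
    refine lt_of_le_of_lt ?_ hB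
    exact Ordinal.iSup_le fun n => Order.add_one_le_of_lt (hFB n n.2)
  · intro η hη
    rw [hlt_iff] at hη ⊢
    obtain ⟨n, hn, hη⟩ := hη
    have hn' : n + 1 < σ.ord := (Cardinal.isSuccLimit_ord hσ.aleph0_le).succ_lt hn
    exact ⟨n + 1, hn', (((hlt _ hn').2 n (lt_add_one n)).2 η hη).le⟩
  · rw [Ordinal.cof_iSup_Iio_add_one hmono, hσ.cof_ord]

/-- The orbit of `x` under a family of functions. -/
inductive Reach (Φ : Set (Ordinal.{0} → Ordinal.{0})) (x : Ordinal.{0}) : Ordinal.{0} → Prop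
  | refl : Reach Φ x x
  | step {y : Ordinal.{0}} {φ : Ordinal.{0} → Ordinal.{0}} (hφ : φ ∈ Φ) (h : Reach Φ x y) :
      Reach Φ x (φ y)

theorem Reach.trans {Φ : Set (Ordinal.{0} → Ordinal.{0})} {x y z : Ordinal.{0}}
    (hxy : Reach Φ x y) (hyz : Reach Φ y z) : Reach Φ x z := by
  induction hyz with
  | refl => exact hxy
  | step hφ _ ih => exact ih.step hφ

theorem Reach.mono {Φ Ψ : Set (Ordinal.{0} → Ordinal.{0})} (h : Φ ⊆ Ψ) {x y : Ordinal.{0}}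
    (hxy : Reach Φ x y) : Reach Ψ x y := by
  induction hxy with
  | refl => exact .refl
  | step hφ _ ih => exact ih.step (h hφ)

theorem Reach.le {Φ : Set (Ordinal.{0} → Ordinal.{0})} (h : ∀ φ ∈ Φ, ∀ x, φ x ≤ x)
    {x y : Ordinal.{0}} (hxy : Reach Φ x y) : y ≤ x := by
  induction hxy with
  | refl => exact le_rfl
  | step hφ _ ih => exact (h _ hφ _).trans ih

theorem mk_reach_le {Φ : Set (Ordinal.{0} → Ordinal.{0})} {c : Cardinal.{1}}
    (hc : Cardinal.aleph0 ≤ c) (hΦ : Cardinal.mk Φ ≤ c) (x : Ordinal.{0}) :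
    Cardinal.mk {y | Reach Φ x y} ≤ c := by
  have hsub : {y | Reach Φ x y} ⊆
      Set.range (fun l : List Φ => l.foldr (fun φ a => φ.1 a) x) := by
    intro y hy
    induction hy with
    | refl => exact ⟨[], rfl⟩
    | @step y φ hφ _ ih =>
      obtain ⟨l, hl⟩ := ih
      exact ⟨⟨φ, hφ⟩ :: l, by simp only [List.foldr_cons]; exact congrArg φ hl⟩
  exact (Cardinal.mk_le_mk_of_subset hsub).trans (Cardinal.mk_range_le.trans
    ((Cardinal.mk_list_le_max _).trans (max_le hc hΦ)))

theorem exists_enumeration {ζ : Ordinal.{0}} {T : Set Ordinal.{0}} {c : Cardinal.{0}}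
    (hT : T ⊆ Set.Iic ζ) (hc : Cardinal.mk T ≤ Cardinal.lift.{1} c) :
    ∃ e : Ordinal.{0} → Ordinal.{0}, (∀ ν, e ν ≤ ζ) ∧ ∀ x ∈ T, ∃ ν < c.ord, e ν = x := by
  classical
  have h : Cardinal.mk T ≤ Cardinal.mk (Set.Iio c.ord) := by
    rwa [Cardinal.mk_Iio_ordinal, Cardinal.card_ord]
  obtain ⟨j⟩ := h
  refine ⟨fun ν => if h : ∃ x : T, (j x).1 = ν then (Classical.choose h).1 else ζ, ?_, ?_⟩
  · intro ν
    dsimp only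
    split_ifs with h
    · exact hT (Classical.choose h).2
    · exact le_rfl
  · intro x hx
    refine ⟨j ⟨x, hx⟩, (j ⟨x, hx⟩).2, ?_⟩
    have h : ∃ y : T, (j y).1 = (j ⟨x, hx⟩).1 := ⟨⟨x, hx⟩, rfl⟩
    dsimp only
    rw [dif_pos h]
    have := j.injective (Subtype.ext (Classical.choose_spec h))
    rw [this]

theorem exists_enumeration_Iic {mu : Cardinal.{0}} (hmu : Cardinal.aleph0 ≤ mu) :
    ∃ g : Ordinal.{0} → Ordinal.{0} → Ordinal.{0}, (∀ ζ ν, g ζ ν ≤ ζ) ∧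
      ∀ ζ < (Order.succ mu).ord, ∀ x ≤ ζ, ∃ ν < mu.ord, g ζ ν = x := by
  have hg : ∀ ζ, ∃ g : Ordinal.{0} → Ordinal.{0}, (∀ ν, g ν ≤ ζ) ∧
      (ζ < (Order.succ mu).ord → ∀ x ≤ ζ, ∃ ν < mu.ord, g ν = x) := by
    intro ζ
    by_cases hζ : ζ < (Order.succ mu).ord
    · have hζ' : ζ + 1 < (Order.succ mu).ord :=
        (Cardinal.isSuccLimit_ord (hmu.trans (Order.le_succ mu))).succ_lt hζ
      obtain ⟨g, hg, hgx⟩ := exists_enumeration (ζ := ζ) (T := Set.Iio (ζ + 1)) (c := mu)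
        (fun x hx => Set.mem_Iic.2 (Order.lt_add_one_iff.1 (Set.mem_Iio.1 hx))) (by
          rw [Cardinal.mk_Iio_ordinal]
          exact Cardinal.lift_le.2 (Order.lt_succ_iff.1 (Cardinal.lt_ord.1 hζ')))
      exact ⟨g, hg, fun _ x hx => hgx x (Order.lt_add_one_iff.2 hx)⟩
    · exact ⟨fun _ => ζ, fun _ => le_rfl, fun h => absurd h hζ⟩
  choose g hg hgx using hg
  exact ⟨g, hg, hgx⟩

theorem exists_cofinal_enumeration (ζ : Ordinal.{0}) :
    ∃ e : Ordinal.{0} → Ordinal.{0}, (∀ ν, e ν ≤ ζ) ∧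
      ∀ x < ζ, ∃ ν < ζ.cof.ord, x ≤ e ν ∧ e ν < ζ := by
  obtain ⟨s, hs, hsc⟩ := Order.exists_cof_eq (Set.Iio ζ)
  rw [Ordinal.cof_Iio, ← Ordinal.lift_cof] at hsc
  obtain ⟨e, he, hes⟩ := exists_enumeration (ζ := ζ) (T := Subtype.val '' s) (c := ζ.cof)
    (by rintro _ ⟨y, _, rfl⟩; exact le_of_lt (Set.mem_Iio.1 y.2)) (Cardinal.mk_image_le.trans hsc.le)
  refine ⟨e, he, fun x hx => ?_⟩
  obtain ⟨y, hy, hxy⟩ := hs ⟨x, hx⟩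
  obtain ⟨ν, hν, hνy⟩ := hes y ⟨y, hy, rfl⟩
  exact ⟨ν, hν, hνy ▸ hxy, hνy ▸ y.2⟩

/-- A system of hulls `H i δ ⊆ δ + 1` with `H i δ` of size at most `mus i`, which is transitive,
exhaustive, and for every club of `μ⁺` (presented as the closure points of a function) contains,
for some `δ` and all `i`, points of the club with cofinality above `mus i`. -/
structure HullSystem (mu κ : Cardinal.{0}) (mus : Ordinal.{0} → Cardinal.{0})
    (H : Ordinal.{0} → Ordinal.{0} → Set Ordinal.{0}) : Prop where
  mk_le : ∀ i < κ.ord, ∀ δ, Cardinal.mk (H i δ) ≤ Cardinal.lift.{1} (mus i)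
  le : ∀ i δ, ∀ x ∈ H i δ, x ≤ δ
  trans : ∀ i x y z, x ∈ H i y → y ∈ H i z → x ∈ H i z
  exhaust : ∀ x y, x ≤ y → y < (Order.succ mu).ord →
    ∃ i0 < κ.ord, ∀ i, i0 ≤ i → i < κ.ord → x ∈ H i y
  guess : ∀ b : Ordinal.{0} → Ordinal.{0},
    (∀ x < (Order.succ mu).ord, b x < (Order.succ mu).ord) →
    ∃ δ < (Order.succ mu).ord, ∀ i < κ.ord, ∃ α ∈ H i δ, mus i < α.cof ∧ ClosedPt b α

theorem exists_minimizer {θ : Ordinal.{0}} (hθ : 0 < θ) (a : Ordinal.{0} → Ordinal.{0}) :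
    ∃ n < θ, ∀ m < θ, a n ≤ a m := by
  obtain ⟨n, hn, h⟩ := WellFounded.has_min
    (InvImage.wf a (wellFounded_lt (α := Ordinal.{0}))) (Set.Iio θ) ⟨0, hθ⟩
  exact ⟨n, hn, fun m hm => not_lt.1 (h m hm)⟩

theorem exists_guessing_family {mu κ : Cardinal.{0}} {mus : Ordinal.{0} → Cardinal.{0}}
    (hmu : Cardinal.aleph0 ≤ mu) (hκ : κ.IsRegular) (hκmu : κ < mu)
    (hreg : ∀ i < κ.ord, (mus i).IsRegular) (hlt : ∀ i < κ.ord, mus i < mu)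
    {Base : Ordinal.{0} → Set (Ordinal.{0} → Ordinal.{0})}
    (hcof : ∀ i < κ.ord, ∀ ζ : Ordinal.{0}, ζ.cof ≤ mus i →
      ∀ x < ζ, ∃ φ ∈ Base i, x ≤ φ ζ ∧ φ ζ < ζ) :
    ∃ Ψ : Set (Ordinal.{0} → Ordinal.{0}), Cardinal.mk Ψ ≤ Cardinal.lift.{1} κ ∧
      (∀ φ ∈ Ψ, ∀ x, φ x ≤ x) ∧
      ∀ b : Ordinal.{0} → Ordinal.{0},
        (∀ x < (Order.succ mu).ord, b x < (Order.succ mu).ord) →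
        ∃ δ < (Order.succ mu).ord, ∀ i < κ.ord, ∃ α, Reach (Base i ∪ Ψ) δ α ∧
          mus i < α.cof ∧ ClosedPt b α := by
  have hc : (Order.succ mu).IsRegular := Cardinal.isRegular_succ hmu
  have hθ : (Order.succ κ).IsRegular := Cardinal.isRegular_succ hκ.aleph0_le
  have hθc : (Order.succ κ).ord < (Order.succ mu).ord :=
    Cardinal.ord_lt_ord.2 (Order.succ_lt_succ hκmu)
  by_contra hcon
  have hbad : ∀ Ψ : Set (Ordinal.{0} → Ordinal.{0}), ∃ b : Ordinal.{0} → Ordinal.{0},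
      Cardinal.mk Ψ ≤ Cardinal.lift.{1} κ → (∀ φ ∈ Ψ, ∀ x, φ x ≤ x) →
        (∀ x < (Order.succ mu).ord, b x < (Order.succ mu).ord) ∧
        ∀ δ < (Order.succ mu).ord, ∃ i < κ.ord, ∀ α, Reach (Base i ∪ Ψ) δ α →
          mus i < α.cof → ¬ ClosedPt b α := by
    intro Ψ
    by_contra hb
    push Not at hb
    have h0 := hb id
    refine hcon ⟨Ψ, h0.1, h0.2.1, fun b hbL => ?_⟩
    exact (hb b).2.2 hbL
  choose bad hbad using hbad
  obtain ⟨F, hF⟩ := exists_recursion (fun S => bad (lastClosed '' S))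
  let Ψ : Ordinal.{0} → Set (Ordinal.{0} → Ordinal.{0}) := fun n => lastClosed '' (F '' Set.Iio n)
  have hΨmono : ∀ m n, m ≤ n → Ψ m ⊆ Ψ n := fun m n hmn =>
    Set.image_mono (Set.image_mono (Set.Iio_subset_Iio hmn))
  have hΨle : ∀ n, ∀ φ ∈ Ψ n, ∀ x, φ x ≤ x := by
    rintro n _ ⟨b, _, rfl⟩ x
    exact lastClosed_le b x
  have hΨcard : ∀ n < (Order.succ κ).ord, Cardinal.mk (Ψ n) ≤ Cardinal.lift.{1} κ := by
    intro n hn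
    refine Cardinal.mk_image_le.trans (Cardinal.mk_image_le.trans ?_)
    rw [Cardinal.mk_Iio_ordinal]
    exact Cardinal.lift_le.2 (Order.lt_succ_iff.1 (Cardinal.lt_ord.1 hn))
  have hFbad : ∀ n < (Order.succ κ).ord,
      (∀ x < (Order.succ mu).ord, F n x < (Order.succ mu).ord) ∧
        ∀ δ < (Order.succ mu).ord, ∃ i < κ.ord, ∀ α, Reach (Base i ∪ Ψ n) δ α →
          mus i < α.cof → ¬ ClosedPt (F n) α := by
    intro n hn
    rw [hF n]
    exact hbad (Ψ n) (hΨcard n hn) (hΨle n)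
  have hB : ∀ x, ∃ B, x < (Order.succ mu).ord →
      B < (Order.succ mu).ord ∧ ∀ n < (Order.succ κ).ord, F n x < B := by
    intro x
    by_cases hx : x < (Order.succ mu).ord
    · obtain ⟨B, hB, h⟩ := exists_bound_Iio hc hθc (h := fun n => F n x)
        (fun n hn => (hFbad n hn).1 x hx)
      exact ⟨B, fun _ => ⟨hB, h⟩⟩
    · exact ⟨0, fun h => absurd h hx⟩
  choose B hB using hB
  have hξ : ∀ i, ∃ ξ, i < κ.ord →
      ξ < (Order.succ mu).ord ∧ ClosedPt B ξ ∧ mus i < ξ.cof := by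
    intro i
    by_cases hi : i < κ.ord
    · obtain ⟨ξ, h1, h2, h3⟩ := exists_closedPt_cof hc
        (Cardinal.isRegular_succ (hreg i hi).aleph0_le) (Order.succ_lt_succ (hlt i hi))
        (fun x hx => (hB x hx).1)
      exact ⟨ξ, fun _ => ⟨h1, h2, h3 ▸ Order.lt_succ _⟩⟩
    · exact ⟨0, fun h => absurd h hi⟩
  choose ξ hξ using hξ
  have hκc : κ.ord < (Order.succ mu).ord :=
    Cardinal.ord_lt_ord.2 (hκmu.trans (Order.lt_succ mu))
  obtain ⟨δ, hδ, hξδ⟩ := exists_bound_Iio hc hκc (fun i hi => (hξ i hi).1)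
  have hδ1 : δ + 1 < (Order.succ mu).ord := (Cardinal.isSuccLimit_ord hc.aleph0_le).succ_lt hδ
  let A : Ordinal.{0} → Ordinal.{0} → Set Ordinal.{0} := fun i n =>
    {x | ξ i ≤ x ∧ Reach (Base i ∪ Ψ n) (δ + 1) x}
  have hAmem : ∀ i < κ.ord, ∀ n, sInf (A i n) ∈ A i n := fun i hi n =>
    csInf_mem ⟨δ + 1, (hξδ i hi).le.trans (le_add_of_nonneg_right zero_le_one), .refl⟩
  have hmin : ∀ i, ∃ n < (Order.succ κ).ord, ∀ m < (Order.succ κ).ord,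
      sInf (A i n) ≤ sInf (A i m) := fun i => exists_minimizer hθ.ord_pos _
  choose N hN hNmin using hmin
  obtain ⟨n, hn, hNn⟩ := exists_bound_Iio hθ (Cardinal.ord_lt_ord.2 (Order.lt_succ κ))
    (fun i _ => hN i)
  have hn1 : n + 1 < (Order.succ κ).ord := (Cardinal.isSuccLimit_ord hθ.aleph0_le).succ_lt hn
  obtain ⟨i, hi, hbadi⟩ := (hFbad n hn).2 (δ + 1) hδ1
  have hanti : ∀ m m', m ≤ m' → A i m ⊆ A i m' := fun m m' h x hx =>
    ⟨hx.1, hx.2.mono (Set.union_subset_union_right _ (hΨmono m m' h))⟩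
  set α := sInf (A i n) with hα
  have hαn : α ∈ A i n := hAmem i hi n
  have hα_le : α ≤ sInf (A i (n + 1)) :=
    (csInf_le' (hanti _ _ (hNn i hi).le (hAmem i hi _))).trans (hNmin i _ hn1)
  refine hbadi α hαn.2 ?_ ?_
  · by_contra hcofα
    rw [not_lt] at hcofα
    rcases hαn.1.eq_or_lt with heq | hlt'
    · exact absurd (heq ▸ (hξ i hi).2.2) (not_lt.2 hcofα)
    · obtain ⟨φ, hφ, h1, h2⟩ := hcof i hi α hcofα _ hlt'
      exact absurd (csInf_le' (s := A i n) ⟨h1, hαn.2.step (Or.inl hφ)⟩) (not_le.2 h2)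
  · have hmem : lastClosed (F n) α ∈ A i (n + 1) := by
      refine ⟨le_lastClosed hαn.1 ?_, (hanti _ _ (le_add_of_nonneg_right zero_le_one) hαn).2.step
        (Or.inr ⟨F n, ⟨n, lt_add_one n, rfl⟩, rfl⟩)⟩
      intro η hη
      exact ((hB η (hη.trans (hξ i hi).1)).2 n hn).trans ((hξ i hi).2.1 η hη)
    have : α = lastClosed (F n) α :=
      (hα_le.trans (csInf_le' hmem)).antisymm (lastClosed_le _ _)
    rw [this]
    exact closedPt_lastClosed _ _

theorem exists_hullSystem {mu κ : Cardinal.{0}} {mus : Ordinal.{0} → Cardinal.{0}}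
    (hmu : Cardinal.aleph0 ≤ mu) (hκ : κ.IsRegular) (hκmus : ∀ i < κ.ord, κ < mus i)
    (hreg : ∀ i < κ.ord, (mus i).IsRegular) (hlt : ∀ i < κ.ord, mus i < mu)
    (hmono : ∀ i j, i ≤ j → j < κ.ord → mus i ≤ mus j)
    (hunb : ∀ θ < mu, ∃ i < κ.ord, θ < mus i) :
    ∃ H, HullSystem mu κ mus H := by
  obtain ⟨g, hg, hgx⟩ := exists_enumeration_Iic hmu
  choose e he hex using exists_cofinal_enumeration
  let Base : Ordinal.{0} → Set (Ordinal.{0} → Ordinal.{0}) := fun i =>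
    (fun ν ζ => g ζ ν) '' Set.Iio (mus i).ord ∪ (fun ν ζ => e ζ ν) '' Set.Iio (mus i).ord
  have hBase : ∀ i, ∀ φ ∈ Base i, ∀ x, φ x ≤ x := by
    rintro i _ (⟨ν, _, rfl⟩ | ⟨ν, _, rfl⟩) x
    exacts [hg x ν, he x ν]
  have hκmu : κ < mu :=
    (hκmus 0 hκ.ord_pos).trans (hlt 0 hκ.ord_pos)
  obtain ⟨Ψ, hΨcard, hΨle, hΨ⟩ := exists_guessing_family hmu hκ hκmu hreg hlt
    (Base := Base) (by
      intro i hi ζ hζ x hx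
      obtain ⟨ν, hν, h⟩ := hex ζ x hx
      exact ⟨_, Or.inr ⟨ν, hν.trans_le (Cardinal.ord_le_ord.2 hζ), rfl⟩, h⟩)
  refine ⟨fun i δ => {x | Reach (Base i ∪ Ψ) δ x}, ?_, ?_, ?_, ?_, ?_⟩
  · intro i hi δ
    have hinf : Cardinal.aleph0 ≤ Cardinal.lift.{1} (mus i) :=
      Cardinal.aleph0_le_lift.2 (hreg i hi).aleph0_le
    have himg : ∀ f : Ordinal.{0} → Ordinal.{0} → Ordinal.{0},
        Cardinal.mk (f '' Set.Iio (mus i).ord) ≤ Cardinal.lift.{1} (mus i) := fun f =>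
      Cardinal.mk_image_le.trans (by rw [Cardinal.mk_Iio_ordinal, Cardinal.card_ord])
    refine mk_reach_le hinf ((Cardinal.mk_union_le _ _).trans
      (Cardinal.add_le_of_le hinf ((Cardinal.mk_union_le _ _).trans
        (Cardinal.add_le_of_le hinf (himg _) (himg _))) (hΨcard.trans ?_))) δ
    exact Cardinal.lift_le.2 (hκmus i hi).le
  · intro i δ x hx
    exact Reach.le (fun φ hφ => hφ.elim (hBase i φ) (hΨle φ)) hx
  · intro i x y z hxy hyz
    exact Reach.trans hyz hxy
  · intro x y hxy hy
    obtain ⟨ν, hν, rfl⟩ := hgx y hy x hxy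
    obtain ⟨i0, hi0, hνi⟩ := hunb _ (Cardinal.lt_ord.1 hν)
    refine ⟨i0, hi0, fun i h hi => Reach.refl.step (φ := fun ζ => g ζ ν) (Or.inl (Or.inl
      ⟨ν, ?_, rfl⟩))⟩
    exact Cardinal.lt_ord.2 (hνi.trans_le (hmono i0 i h hi))
  · exact hΨ

theorem exists_fixed_of_unbounded {c : Cardinal.{0}} (hc : c.IsRegular) {γ : Ordinal.{0}}
    (hγ : γ < c.ord) {P : Ordinal.{0} → Ordinal.{0} → Prop} {Z : Set Ordinal.{0}}
    (h : UnbddIn {y ∈ Z | ∃ ν < γ, P y ν} c.ord) :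
    ∃ ν < γ, UnbddIn {y ∈ Z | P y ν} c.ord := by
  by_contra hcon
  have hbad : ∀ ν < γ, ∃ x < c.ord, ∀ y ∈ Z, P y ν → x ≤ y → ¬ y < c.ord := by
    intro ν hν
    by_contra hb
    push Not at hb
    refine hcon ⟨ν, hν, fun x hx => ?_⟩
    obtain ⟨y, h1, h2, h3, h4⟩ := hb x hx
    exact ⟨y, ⟨h1, h2⟩, h3, h4⟩
  choose! x hx hbad using hbad
  obtain ⟨B, hB, hxB⟩ := exists_bound_Iio hc hγ hx
  obtain ⟨y, ⟨hyZ, ν, hν, hP⟩, hBy, hy⟩ := h B hB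
  exact hbad ν hν y hyZ hP ((hxB ν hν).le.trans hBy) hy

theorem exists_decoding {κ : Cardinal.{0}} (hκ : κ.IsRegular) :
    ∃ p q : Ordinal.{0} → Ordinal.{0}, ∀ i < κ.ord, ∀ k < κ.ord, ∀ j0 < κ.ord,
      ∃ j, j0 ≤ j ∧ j < κ.ord ∧ p j = i ∧ q j = k := by
  classical
  have hcard : Cardinal.mk (Set.Iio κ.ord) =
      Cardinal.mk (Set.Iio κ.ord × Set.Iio κ.ord × Set.Iio κ.ord) := by
    have hinf : Cardinal.aleph0 ≤ Cardinal.lift.{1} κ := Cardinal.aleph0_le_lift.2 hκ.aleph0_le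
    simp only [Cardinal.mk_prod, Cardinal.mk_Iio_ordinal, Cardinal.card_ord, Cardinal.lift_id,
      Cardinal.mul_eq_self hinf]
  obtain ⟨e⟩ := Cardinal.eq.1 hcard
  refine ⟨fun j => if h : j < κ.ord then (e ⟨j, h⟩).1.1 else 0,
    fun j => if h : j < κ.ord then (e ⟨j, h⟩).2.1.1 else 0, fun i hi k hk j0 hj0 => ?_⟩
  by_contra hcon
  have hlt : ∀ m : Set.Iio κ.ord, (e.symm (⟨i, hi⟩, ⟨k, hk⟩, m)).1 < j0 := by
    intro m
    by_contra hm
    have hm' : (e.symm (⟨i, hi⟩, ⟨k, hk⟩, m)).1 < κ.ord := (e.symm _).2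
    have he : e ⟨(e.symm (⟨i, hi⟩, ⟨k, hk⟩, m)).1, hm'⟩ = (⟨i, hi⟩, ⟨k, hk⟩, m) :=
      e.apply_symm_apply _
    refine hcon ⟨_, not_lt.1 hm, hm', ?_, ?_⟩ <;> simp only [dif_pos hm', he]
  have hinj : Function.Injective
      (fun m : Set.Iio κ.ord => (⟨_, hlt m⟩ : Set.Iio j0)) := by
    intro m m' h
    have := e.symm.injective (Subtype.ext (Subtype.mk.inj h))
    simpa using this
  have := Cardinal.mk_le_of_injective hinj
  rw [Cardinal.mk_Iio_ordinal, Cardinal.mk_Iio_ordinal, Cardinal.lift_le, Cardinal.card_ord] at this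
  exact absurd (Cardinal.lt_ord.1 hj0) (not_lt.2 this)

namespace IsScale

variable {mu : Cardinal.{0}} {mus : Ordinal.{0} → Cardinal.{0}}
  {f : Ordinal.{0} → Ordinal.{0} → Ordinal.{0}}

theorem exists_dominating (hs : IsScale mu mus f) (hκ : mu.ord.cof.IsRegular)
    {g : Ordinal.{0} → Ordinal.{0}} (hg : ∀ i, i < cofOrd mu → g i < (mus i).ord) :
    ∃ γ < sucOrd mu, ∀ t : Set Ordinal.{0}, (∀ z ∈ t, γ < z ∧ z < sucOrd mu) →
      CardLT t mu.ord.cof →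
      ∃ i0 < cofOrd mu, ∀ z ∈ t, ∀ i, i0 ≤ i → i < cofOrd mu → g i < f z i := by
  obtain ⟨γ, hγ, i0, hi0, hgγ⟩ := hs.f_cofinal g hg
  refine ⟨γ, hγ, fun t ht htc => ?_⟩
  have h : ∀ z ∈ t, ∃ i1, i1 < cofOrd mu ∧ ∀ i, i1 ≤ i → i < cofOrd mu → f γ i < f z i :=
    fun z hz => hs.f_mono γ z (ht z hz).1 (ht z hz).2
  choose! i1 hi1 hf using h
  obtain ⟨B, hB, hiB⟩ := exists_bound_of_regular hκ htc hi1
  exact ⟨max i0 B, max_lt hi0 hB, fun z hz i hi hiK =>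
    (hgγ i ((le_max_left _ _).trans hi) hiK).trans
      (hf z hz i ((hiB z hz).le.trans ((le_max_right _ _).trans hi)) hiK)⟩

theorem cof_lt_mus (hs : IsScale mu mus f) {i : Ordinal.{0}} (hi : i < cofOrd mu) :
    mu.ord.cof < mus i := by
  rcases eq_or_ne i 0 with rfl | h
  · exact hs.cof_lt
  · exact hs.cof_lt.trans (hs.strictMono 0 i (pos_iff_ne_zero.2 h) hi)

theorem mono (hs : IsScale mu mus f) {i j : Ordinal.{0}} (hij : i ≤ j) (hj : j < cofOrd mu) :
    mus i ≤ mus j := by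
  rcases hij.eq_or_lt with rfl | h
  · exact le_rfl
  · exact (hs.strictMono i j h hj).le

theorem mus_lt (hs : IsScale mu mus f) (hκ : mu.ord.cof.IsRegular) {i : Ordinal.{0}}
    (hi : i < cofOrd mu) : mus i < mu := by
  have h : i + 1 < cofOrd mu := (Cardinal.isSuccLimit_ord hκ.aleph0_le).succ_lt hi
  exact (hs.strictMono i _ (lt_add_one i) h).trans_le (hs.le_mu _ h)

theorem exists_unbounded_value (hs : IsScale mu mus f) (hκ : mu.ord.cof.IsRegular)
    (hmu : Cardinal.aleph0 ≤ mu) {Z : Set Ordinal.{0}} (hZ : UnbddIn Z (sucOrd mu)) :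
    ∃ k0 < cofOrd mu, ∀ k, k0 ≤ k → k < cofOrd mu →
      UnbddIn {v | UnbddIn {z ∈ Z | f z k = v} (sucOrd mu)} (mus k).ord := by
  have hc : (Order.succ mu).IsRegular := Cardinal.isRegular_succ hmu
  have hKL : cofOrd mu < sucOrd mu := Cardinal.ord_lt_ord.2
    (((hs.cof_lt_mus hκ.ord_pos).trans (hs.mus_lt hκ hκ.ord_pos)).trans (Order.lt_succ mu))
  have hL : ∀ x < sucOrd mu, x + 1 < sucOrd mu := fun x hx =>
    (Cardinal.isSuccLimit_ord hc.aleph0_le).succ_lt hx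
  have key : ∀ k, ∃ v0 x, k < cofOrd mu → v0 < (mus k).ord ∧ x < sucOrd mu ∧
      (UnbddIn {v | UnbddIn {z ∈ Z | f z k = v} (sucOrd mu)} (mus k).ord ∨
        ∀ z ∈ Z, x ≤ z → z < sucOrd mu → f z k ≤ v0) := by
    intro k
    by_cases hk : k < cofOrd mu
    swap
    · exact ⟨0, 0, fun h => absurd h hk⟩
    by_cases hgood : UnbddIn {v | UnbddIn {z ∈ Z | f z k = v} (sucOrd mu)} (mus k).ord
    · exact ⟨0, 0, fun _ => ⟨(hs.regular k hk).ord_pos, hc.ord_pos, Or.inl hgood⟩⟩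
    obtain ⟨v0, hv0, hbad⟩ : ∃ v0 < (mus k).ord, ∀ v, UnbddIn {z ∈ Z | f z k = v} (sucOrd mu) →
        v0 ≤ v → ¬ v < (mus k).ord := by
      by_contra hb
      push Not at hb
      refine hgood fun v0 hv0 => ?_
      obtain ⟨v, h1, h2, h3⟩ := hb v0 hv0
      exact ⟨v, h1, h2, h3⟩
    by_contra hcon
    push Not at hcon
    obtain ⟨ν, hν, hun⟩ := exists_fixed_of_unbounded hc (γ := (mus k).ord) (Z := Z)
      (P := fun z v => v0 ≤ v ∧ f z k = v)
      (Cardinal.ord_lt_ord.2 ((hs.mus_lt hκ hk).trans (Order.lt_succ mu))) (by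
        intro x hx
        obtain ⟨z, hz, hxz, hzL, hlt⟩ := ((hcon v0 x).2 hv0 hx).2
        exact ⟨z, ⟨hz, f z k, hs.f_lt z hzL k hk, hlt.le, rfl⟩, hxz, hzL⟩)
    refine hbad ν (fun x hx => ?_) ?_ hν
    · obtain ⟨z, hz, h⟩ := hun x hx
      exact ⟨z, ⟨hz.1, hz.2.2⟩, h⟩
    · obtain ⟨z, hz, h⟩ := hun 0 hc.ord_pos
      exact hz.2.1
  choose v0 x hv0 using key
  obtain ⟨B, hB, hxB⟩ := exists_bound_Iio hc hKL (fun k hk => (hv0 k hk).2.1)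
  obtain ⟨γ, hγ, hdom⟩ := hs.exists_dominating hκ (fun k hk => (hv0 k hk).1)
  obtain ⟨z, hz, hle, hzL⟩ := hZ _ (max_lt hB (hL γ hγ))
  obtain ⟨k0, hk0, h⟩ := hdom {z} (by
      rintro _ rfl
      exact ⟨Order.add_one_le_iff.1 ((le_max_right _ _).trans hle), hzL⟩) (by
      unfold CardLT
      rw [Cardinal.mk_singleton]
      exact Cardinal.one_lt_aleph0.trans_le (Cardinal.aleph0_le_lift.2 hκ.aleph0_le))
  refine ⟨k0, hk0, fun k hk hkK => ?_⟩
  rcases (hv0 k hkK).2.2 with hgood | hbad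
  · exact hgood
  · exact absurd (h z rfl k hk hkK)
      (not_lt.2 (hbad z hz ((hxB k hkK).le.trans ((le_max_left _ _).trans hle)) hzL))

theorem exists_large_left (hs : IsScale mu mus f) (hκ : mu.ord.cof.IsRegular)
    (hmu : Cardinal.aleph0 ≤ mu) {X : Set Ordinal.{0}} {s : Ordinal.{0} → Set Ordinal.{0}}
    (hX : UnbddIn X (sucOrd mu)) (hsub : ∀ x ∈ X, x < sucOrd mu → ∀ ξ ∈ s x, x ≤ ξ ∧ ξ < sucOrd mu)
    (hcard : ∀ x ∈ X, x < sucOrd mu → CardLT (s x) mu.ord.cof) :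
    ∃ j0 < cofOrd mu, ∀ j, j0 ≤ j → j < cofOrd mu → ∀ w < (mus j).ord,
      ∃ x ∈ X, x < sucOrd mu ∧ ∀ ξ ∈ s x, w ≤ f ξ j := by
  have key : ∀ j, ∃ w, j < cofOrd mu → w < (mus j).ord ∧
      ((∀ w < (mus j).ord, ∃ x ∈ X, x < sucOrd mu ∧ ∀ ξ ∈ s x, w ≤ f ξ j) ∨
        ∀ x ∈ X, x < sucOrd mu → ∃ ξ ∈ s x, f ξ j < w) := by
    intro j
    by_cases hj : j < cofOrd mu
    swap
    · exact ⟨0, fun h => absurd h hj⟩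
    by_contra hcon
    push Not at hcon
    obtain ⟨-, h⟩ := hcon 0
    obtain ⟨⟨w, hw, hbad⟩, -⟩ := h (hs.regular j hj).ord_pos
    obtain ⟨x, hx, hxL, hxw⟩ := ((hcon w).2 hw).2
    obtain ⟨ξ, hξ, hlt⟩ := hbad x hx hxL
    exact absurd hlt (not_lt.2 (hxw ξ hξ))
  choose w hw using key
  obtain ⟨γ, hγ, hdom⟩ := hs.exists_dominating hκ (fun k hk => (hw k hk).1)
  obtain ⟨x, hx, hle, hxL⟩ := hX (γ + 1)
    ((Cardinal.isSuccLimit_ord (hmu.trans (Order.le_succ mu))).succ_lt hγ)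
  obtain ⟨j0, hj0, h⟩ := hdom (s x) (fun ξ hξ =>
    ⟨(Order.add_one_le_iff.1 hle).trans_le (hsub x hx hxL ξ hξ).1, (hsub x hx hxL ξ hξ).2⟩)
    (hcard x hx hxL)
  refine ⟨j0, hj0, fun j hj hjK => ?_⟩
  rcases (hw j hjK).2 with hgood | hbad
  · exact hgood
  · obtain ⟨ξ, hξ, hlt⟩ := hbad x hx hxL
    exact absurd hlt (not_lt.2 (h ξ hξ j hj hjK).le)

theorem exists_large_right (hs : IsScale mu mus f) (hκ : mu.ord.cof.IsRegular)
    (hmu : Cardinal.aleph0 ≤ mu) {Y : Set Ordinal.{0}} {t : Ordinal.{0} → Set Ordinal.{0}}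
    (hY : UnbddIn Y (sucOrd mu)) (hsub : ∀ y ∈ Y, y < sucOrd mu → ∀ ζ ∈ t y, y ≤ ζ ∧ ζ < sucOrd mu)
    (hcard : ∀ y ∈ Y, y < sucOrd mu → CardLT (t y) mu.ord.cof) :
    ∃ j0 < cofOrd mu, ∀ j, j0 ≤ j → j < cofOrd mu → ∃ w < (mus j).ord,
      ∀ g : Ordinal.{0} → Ordinal.{0}, (∀ l, l < cofOrd mu → g l < (mus l).ord) →
        ∃ y ∈ Y, y < sucOrd mu ∧ ∀ ζ ∈ t y, f ζ j ≤ w ∧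
          ∀ l, j < l → l < cofOrd mu → g l < f ζ l := by
  have key : ∀ j w, ∃ g : Ordinal.{0} → Ordinal.{0}, (∀ l, l < cofOrd mu → g l < (mus l).ord) ∧
      ((∀ g : Ordinal.{0} → Ordinal.{0}, (∀ l, l < cofOrd mu → g l < (mus l).ord) →
        ∃ y ∈ Y, y < sucOrd mu ∧ ∀ ζ ∈ t y, f ζ j ≤ w ∧
          ∀ l, j < l → l < cofOrd mu → g l < f ζ l) ∨
        ∀ y ∈ Y, y < sucOrd mu → ¬ ∀ ζ ∈ t y, f ζ j ≤ w ∧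
          ∀ l, j < l → l < cofOrd mu → g l < f ζ l) := by
    intro j w
    by_cases hgood : ∀ g : Ordinal.{0} → Ordinal.{0}, (∀ l, l < cofOrd mu → g l < (mus l).ord) →
        ∃ y ∈ Y, y < sucOrd mu ∧ ∀ ζ ∈ t y, f ζ j ≤ w ∧
          ∀ l, j < l → l < cofOrd mu → g l < f ζ l
    · exact ⟨fun _ => 0, fun l hl => (hs.regular l hl).ord_pos, Or.inl hgood⟩
    · rw [not_forall] at hgood
      obtain ⟨g, hg⟩ := hgood
      rw [Classical.not_imp] at hg
      exact ⟨g, hg.1, Or.inr fun y hy hyL h => hg.2 ⟨y, hy, hyL, h⟩⟩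
  choose g hg hgood using key
  have hG : ∀ l, ∃ b, l < cofOrd mu →
      b < (mus l).ord ∧ ∀ j < l, ∀ w < (mus j).ord, g j w l < b := by
    intro l
    by_cases hl : l < cofOrd mu
    swap
    · exact ⟨0, fun h => absurd h hl⟩
    have h1 : ∀ j < l, ∃ b < (mus l).ord, ∀ w < (mus j).ord, g j w l < b := fun j hj =>
      exists_bound_Iio (hs.regular l hl) (Cardinal.ord_lt_ord.2 (hs.strictMono j l hj hl))
        (h := fun w => g j w l) (fun w _ => hg j w l hl)
    choose! b hb hgb using h1
    obtain ⟨B, hB, hbB⟩ := exists_bound_Iio (hs.regular l hl)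
      (hl.trans (Cardinal.ord_lt_ord.2 (hs.cof_lt_mus hl))) hb
    exact ⟨B, fun _ => ⟨hB, fun j hj w hw => (hgb j hj w hw).trans (hbB j hj)⟩⟩
  choose G hG using hG
  obtain ⟨γ, hγ, hdom⟩ := hs.exists_dominating hκ (fun k hk => (hG k hk).1)
  obtain ⟨y, hy, hle, hyL⟩ := hY (γ + 1)
    ((Cardinal.isSuccLimit_ord (hmu.trans (Order.le_succ mu))).succ_lt hγ)
  obtain ⟨j0, hj0, h⟩ := hdom (t y) (fun ξ hξ =>
    ⟨(Order.add_one_le_iff.1 hle).trans_le (hsub y hy hyL ξ hξ).1, (hsub y hy hyL ξ hξ).2⟩)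
    (hcard y hy hyL)
  refine ⟨j0, hj0, fun j hj hjK => ?_⟩
  obtain ⟨w, hw, hfw⟩ := exists_bound_of_regular (hs.regular j hjK)
    ((hcard y hy hyL).trans (Cardinal.lift_lt.2 (hs.cof_lt_mus hjK))) (h := fun ζ => f ζ j)
    (fun ζ hζ => hs.f_lt ζ (hsub y hy hyL ζ hζ).2 j hjK)
  refine ⟨w, hw, (hgood j w).resolve_right fun hbad => hbad y hy hyL fun ζ hζ =>
    ⟨(hfw ζ hζ).le, fun l hjl hl => ?_⟩⟩
  exact ((hG l hl).2 j hjl w hw).trans (h ζ hζ l (hj.trans hjl.le) hl)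

end IsScale

/-- `j` is the last index below `K` at which `f ζ` fails to exceed `f ξ`. -/
def IsLastIndex (f : Ordinal.{0} → Ordinal.{0} → Ordinal.{0}) (K ξ ζ j : Ordinal.{0}) : Prop :=
  f ζ j ≤ f ξ j ∧ ∀ l, j < l → l < K → f ξ l < f ζ l

theorem IsLastIndex.unique {f : Ordinal.{0} → Ordinal.{0} → Ordinal.{0}} {K ξ ζ j j' : Ordinal.{0}}
    (h : IsLastIndex f K ξ ζ j) (h' : IsLastIndex f K ξ ζ j') (hj : j < K) (hj' : j' < K) :
    j = j' := by
  rcases lt_trichotomy j j' with hlt | rfl | hlt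
  · exact absurd (h.2 j' hlt hj') (not_lt.2 h'.1)
  · rfl
  · exact absurd (h'.2 j hlt hj) (not_lt.2 h.1)

namespace IsScale

variable {mu : Cardinal.{0}} {mus : Ordinal.{0} → Cardinal.{0}}
  {f : Ordinal.{0} → Ordinal.{0} → Ordinal.{0}}

theorem lt_of_isLastIndex (hs : IsScale mu mus f) (hκ : mu.ord.cof.IsRegular)
    {ξ ζ j : Ordinal.{0}} (h : IsLastIndex f (cofOrd mu) ξ ζ j) (hj : j < cofOrd mu)
    (hξ : ξ < sucOrd mu) : ξ < ζ := by
  have hj1 : j + 1 < cofOrd mu := (Cardinal.isSuccLimit_ord hκ.aleph0_le).succ_lt hj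
  rcases lt_trichotomy ξ ζ with hlt | rfl | hlt
  · exact hlt
  · exact absurd (h.2 _ (lt_add_one j) hj1) (lt_irrefl _)
  · obtain ⟨i0, hi0, hi⟩ := hs.f_mono ζ ξ hlt hξ
    exact absurd (h.2 (max i0 (j + 1)) ((lt_add_one j).trans_le (le_max_right _ _))
      (max_lt hi0 hj1)) (not_lt.2 (hi _ (le_max_left _ _) (max_lt hi0 hj1)).le)

theorem exists_isLastIndex (hs : IsScale mu mus f) (hκ : mu.ord.cof.IsRegular)
    (hmu : Cardinal.aleph0 ≤ mu) {X Y : Set Ordinal.{0}} {s t : Ordinal.{0} → Set Ordinal.{0}}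
    (hX : UnbddIn X (sucOrd mu)) (hY : UnbddIn Y (sucOrd mu))
    (hsX : ∀ x ∈ X, x < sucOrd mu → ∀ ξ ∈ s x, x ≤ ξ ∧ ξ < sucOrd mu)
    (hsc : ∀ x ∈ X, x < sucOrd mu → CardLT (s x) mu.ord.cof)
    (htY : ∀ y ∈ Y, y < sucOrd mu → ∀ ζ ∈ t y, y ≤ ζ ∧ ζ < sucOrd mu)
    (htc : ∀ y ∈ Y, y < sucOrd mu → CardLT (t y) mu.ord.cof) :
    ∃ j0 < cofOrd mu, ∀ j, j0 ≤ j → j < cofOrd mu →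
      ∃ x ∈ X, x < sucOrd mu ∧ ∃ y ∈ Y, y < sucOrd mu ∧
        ∀ ξ ∈ s x, ∀ ζ ∈ t y, IsLastIndex f (cofOrd mu) ξ ζ j := by
  obtain ⟨j1, hj1, hleft⟩ := hs.exists_large_left hκ hmu hX hsX hsc
  obtain ⟨j2, hj2, hright⟩ := hs.exists_large_right hκ hmu hY htY htc
  refine ⟨max j1 j2, max_lt hj1 hj2, fun j hj hjK => ?_⟩
  obtain ⟨w, hw, hg⟩ := hright j ((le_max_right _ _).trans hj) hjK
  obtain ⟨x, hx, hxL, hxw⟩ := hleft j ((le_max_left _ _).trans hj) hjK w hw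
  have h : ∀ l, ∃ b, l < cofOrd mu → b < (mus l).ord ∧ ∀ ξ ∈ s x, f ξ l < b := by
    intro l
    by_cases hl : l < cofOrd mu
    · obtain ⟨b, hb, hfb⟩ := exists_bound_of_regular (hs.regular l hl)
        ((hsc x hx hxL).trans (Cardinal.lift_lt.2 (hs.cof_lt_mus hl))) (h := fun ξ => f ξ l)
        (fun ξ hξ => hs.f_lt ξ (hsX x hx hxL ξ hξ).2 l hl)
      exact ⟨b, fun _ => ⟨hb, hfb⟩⟩
    · exact ⟨0, fun h => absurd h hl⟩
  choose g hgb using h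
  obtain ⟨y, hy, hyL, hyg⟩ := hg g (fun l hl => (hgb l hl).1)
  exact ⟨x, hx, hxL, y, hy, hyL, fun ξ hξ ζ hζ => ⟨(hyg ζ hζ).1.trans (hxw ξ hξ),
    fun l hjl hl => ((hgb l hl).2 ξ hξ).trans ((hyg ζ hζ).2 l hjl hl)⟩⟩

end IsScale

/-- `α` is a point of `H i ζ` for every `ζ ∈ s`, below which `H i ζ` is bounded by `η`, while
`H i ζ` contains `η0`. -/
structure IsGap (H : Ordinal.{0} → Ordinal.{0} → Set Ordinal.{0}) (i η0 η α : Ordinal.{0})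
    (s : Set Ordinal.{0}) : Prop where
  lt : ∀ ζ ∈ s, α < ζ
  mem : ∀ ζ ∈ s, α ∈ H i ζ
  mem_low : ∀ ζ ∈ s, η0 ∈ H i ζ
  bound : ∀ ζ ∈ s, ∀ y ∈ H i ζ, y < α → y < η

theorem HullSystem.exists_isGap {mu κ : Cardinal.{0}} {mus : Ordinal.{0} → Cardinal.{0}}
    {H : Ordinal.{0} → Ordinal.{0} → Set Ordinal.{0}} (hH : HullSystem mu κ mus H)
    (hmu : Cardinal.aleph0 ≤ mu) (hκ : κ.IsRegular) (hκmu : κ < mu)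
    (hreg : ∀ i < κ.ord, (mus i).IsRegular) (hκmus : ∀ i < κ.ord, κ < mus i)
    {t : Ordinal.{0} → Set Ordinal.{0}}
    (hsub : ∀ a < (Order.succ mu).ord, t a ⊆ Set.Iio (Order.succ mu).ord)
    (hcard : ∀ a < (Order.succ mu).ord, CardLT (t a) κ)
    (hfar : ∀ δ < (Order.succ mu).ord, ∃ a, δ ≤ a ∧ a < (Order.succ mu).ord ∧ ∀ ζ ∈ t a, δ < ζ)
    {η0 : Ordinal.{0}} (hη0 : η0 < (Order.succ mu).ord) :
    ∃ i0 < κ.ord, ∀ i, i0 ≤ i → i < κ.ord → ∃ η < (Order.succ mu).ord,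
      UnbddIn {α | ∃ a, α ≤ a ∧ a < (Order.succ mu).ord ∧ IsGap H i η0 η α (t a)}
        (Order.succ mu).ord := by
  have hc : (Order.succ mu).IsRegular := Cardinal.isRegular_succ hmu
  have hκL : κ.ord < (Order.succ mu).ord :=
    Cardinal.ord_lt_ord.2 (hκmu.trans (Order.lt_succ mu))
  set S : Ordinal.{0} → Ordinal.{0} → Set Ordinal.{0} := fun i η =>
    {α | ∃ a, α ≤ a ∧ a < (Order.succ mu).ord ∧ IsGap H i η0 η α (t a)} with hS
  have hx : ∀ i η, ∃ x < (Order.succ mu).ord, ¬ UnbddIn (S i η) (Order.succ mu).ord →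
      ∀ y ∈ S i η, x ≤ y → ¬ y < (Order.succ mu).ord := by
    intro i η
    by_cases h : UnbddIn (S i η) (Order.succ mu).ord
    · exact ⟨0, hc.ord_pos, fun h' => absurd h h'⟩
    · by_contra hcon
      push Not at hcon
      exact h fun x hx => (hcon x hx).2
  choose x hxL hx using hx
  have hb : ∀ η, ∃ b < (Order.succ mu).ord, ∀ i < κ.ord, x i η < b := fun η =>
    exists_bound_Iio hc hκL (h := fun i => x i η) (fun i _ => hxL i η)
  choose b hbL hb using hb
  obtain ⟨δ, hδ, hguess⟩ := hH.guess b (fun η _ => hbL η)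
  obtain ⟨a, hδa, haL, hta⟩ := hfar (max δ η0) (max_lt hδ hη0)
  have hex : ∀ ζ ∈ t a, ∃ i0 < κ.ord, ∀ i, i0 ≤ i → i < κ.ord → δ ∈ H i ζ ∧ η0 ∈ H i ζ := by
    intro ζ hζ
    have hlt := max_lt_iff.1 (hta ζ hζ)
    obtain ⟨i1, hi1, h1⟩ := hH.exhaust δ ζ hlt.1.le (hsub a haL hζ)
    obtain ⟨i2, hi2, h2⟩ := hH.exhaust η0 ζ hlt.2.le (hsub a haL hζ)
    exact ⟨max i1 i2, max_lt hi1 hi2, fun i hi hiK =>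
      ⟨h1 i ((le_max_left _ _).trans hi) hiK, h2 i ((le_max_right _ _).trans hi) hiK⟩⟩
  choose! i0 hi0 hmem using hex
  obtain ⟨B, hB, hi0B⟩ := exists_bound_of_regular hκ (hcard a haL) hi0
  refine ⟨B, hB, fun i hi hiK => ?_⟩
  obtain ⟨α, hα, hcof, hclosed⟩ := hguess i hiK
  have hαδ : α ≤ δ := hH.le i δ α hα
  obtain ⟨η, hη, hbound⟩ := exists_bound_of_lt_cof (o := α) (h := id)
    (S := (⋃ ζ ∈ t a, H i ζ) ∩ Set.Iio α) (by
      refine (Cardinal.mk_le_mk_of_subset Set.inter_subset_left).trans_lt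
        (lt_of_le_of_lt ?_ (Cardinal.lift_lt.2 hcof))
      rw [Set.biUnion_eq_iUnion]
      refine (Cardinal.mk_iUnion_le_sum_mk).trans ((Cardinal.sum_le_mk_mul_iSup _).trans ?_)
      refine (mul_le_mul' ((hcard a haL).le.trans (Cardinal.lift_le.2 (hκmus i hiK).le))
        (ciSup_le' fun ζ : t a => hH.mk_le i hiK ζ.1)).trans ?_
      exact (Cardinal.mul_eq_self (Cardinal.aleph0_le_lift.2 (hreg i hiK).aleph0_le)).le)
    (fun y hy => hy.2)
  refine ⟨η, (hη.trans_le hαδ).trans hδ, ?_⟩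
  by_contra hcon
  have hgap : α ∈ S i η := ⟨a, hαδ.trans ((le_max_left _ _).trans hδa), haL,
    fun ζ hζ => hαδ.trans_lt (max_lt_iff.1 (hta ζ hζ)).1,
    fun ζ hζ => hH.trans i α δ ζ hα (hmem ζ hζ i ((hi0B ζ hζ).le.trans hi) hiK).1,
    fun ζ hζ => (hmem ζ hζ i ((hi0B ζ hζ).le.trans hi) hiK).2,
    fun ζ hζ y hy hyα => hbound y ⟨Set.mem_biUnion hζ hy, hyα⟩⟩
  exact hx i η hcon α hgap ((hb η i hiK).trans (hclosed η hη)).le (hαδ.trans_lt hδ)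

/-- The coloring: the last index `j` at which `f ζ` fails to exceed `f ξ` codes a pair `(i, k)`;
the hulls `H i ζ` and `H i ξ` yield ordinals `β ≥ ξ` and `α`, and the color is obtained by applying
`d k` to `f α k` and `f β k`, followed by `g β`. -/
def hullColor (H : Ordinal.{0} → Ordinal.{0} → Set Ordinal.{0})
    (f g : Ordinal.{0} → Ordinal.{0} → Ordinal.{0}) (p q : Ordinal.{0} → Ordinal.{0})
    (d : Ordinal.{0} → Ordinal.{0} → Ordinal.{0} → Ordinal.{0}) (K ξ ζ : Ordinal.{0}) :
    Ordinal.{0} :=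
  let j := sInf {j | j < K ∧ IsLastIndex f K ξ ζ j}
  let β := sInf (H (p j) ζ ∩ Set.Ici ξ)
  let α := sInf (H (p j) ξ ∩ Set.Ici (sSup (H (p j) ζ ∩ Set.Iio ξ)))
  g β (d (q j) (min (f α (q j)) (f β (q j))) (max (f α (q j)) (f β (q j))))

section hullColor

variable {H : Ordinal.{0} → Ordinal.{0} → Set Ordinal.{0}}
  {f g : Ordinal.{0} → Ordinal.{0} → Ordinal.{0}} {p q : Ordinal.{0} → Ordinal.{0}}
  {d : Ordinal.{0} → Ordinal.{0} → Ordinal.{0} → Ordinal.{0}} {K ξ ζ : Ordinal.{0}}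

theorem hullColor_le (hg : ∀ ζ ν, g ζ ν ≤ ζ) (hH : ∀ i δ, ∀ x ∈ H i δ, x ≤ δ) :
    hullColor H f g p q d K ξ ζ ≤ ζ := by
  refine (hg _ _).trans ?_
  rcases Set.eq_empty_or_nonempty
    (H (p (sInf {j | j < K ∧ IsLastIndex f K ξ ζ j})) ζ ∩ Set.Ici ξ) with h | h
  · rw [h, Ordinal.sInf_empty]
    exact zero_le
  · exact hH _ _ _ (csInf_mem h).1

theorem hullColor_eq {i j η0 η0' η1 α β : Ordinal.{0}} (hj : j < K)
    (hlast : IsLastIndex f K ξ ζ j) (hpj : p j = i) {s s' : Set Ordinal.{0}} {η : Ordinal.{0}}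
    (hα : IsGap H i η0' η α s) (hβ : IsGap H i η0 η1 β s') (hξ : ξ ∈ s) (hζ : ζ ∈ s')
    (hη : η ≤ η0) (hη0 : η0 < α) (hη1 : η1 < α) (hξβ : ξ < β) :
    hullColor H f g p q d K ξ ζ =
      g β (d (q j) (min (f α (q j)) (f β (q j))) (max (f α (q j)) (f β (q j)))) := by
  have hαξ := hα.lt ξ hξ
  have h1 : sInf {j | j < K ∧ IsLastIndex f K ξ ζ j} = j := by
    have : {j | j < K ∧ IsLastIndex f K ξ ζ j} = {j} := by
      ext j'
      constructor
      · exact fun h => h.2.unique hlast h.1 hj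
      · rintro rfl
        exact ⟨hj, hlast⟩
    rw [this, csInf_singleton]
  have h2 : sInf (H i ζ ∩ Set.Ici ξ) = β := by
    refine le_antisymm (csInf_le' ⟨hβ.mem ζ hζ, hξβ.le⟩)
      (le_csInf ⟨β, hβ.mem ζ hζ, hξβ.le⟩ fun y hy => ?_)
    by_contra hlt
    exact absurd hy.2 (not_le.2 (((hβ.bound ζ hζ y hy.1 (not_le.1 hlt)).trans hη1).trans hαξ))
  have hlow : η0 ≤ sSup (H i ζ ∩ Set.Iio ξ) :=
    le_csSup ⟨ξ, fun y hy => le_of_lt hy.2⟩ ⟨hβ.mem_low ζ hζ, hη0.trans hαξ⟩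
  have hhigh : sSup (H i ζ ∩ Set.Iio ξ) ≤ η1 :=
    csSup_le' fun y hy => (hβ.bound ζ hζ y hy.1 (lt_trans hy.2 hξβ)).le
  have h3 : sInf (H i ξ ∩ Set.Ici (sSup (H i ζ ∩ Set.Iio ξ))) = α := by
    refine le_antisymm (csInf_le' ⟨hα.mem ξ hξ, hhigh.trans hη1.le⟩)
      (le_csInf ⟨α, hα.mem ξ hξ, hhigh.trans hη1.le⟩ fun y hy => ?_)
    by_contra hlt
    exact absurd hy.2
      (not_le.2 ((hα.bound ξ hξ y hy.1 (not_le.1 hlt)).trans_le (hη.trans hlow)))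
  unfold hullColor
  simp only [h1, hpj, h2, h3]

end hullColor

theorem UnbddIn.inter_Ioi {Z : Set Ordinal.{0}} {c : Cardinal.{0}} (hc : Cardinal.aleph0 ≤ c)
    (hZ : UnbddIn Z c.ord) {x : Ordinal.{0}} (hx : x < c.ord) : UnbddIn (Z ∩ Set.Ioi x) c.ord := by
  intro y hy
  obtain ⟨z, hz, hle, hzc⟩ := hZ (max y (x + 1))
    (max_lt hy ((Cardinal.isSuccLimit_ord hc).succ_lt hx))
  exact ⟨z, ⟨hz, Order.add_one_le_iff.1 ((le_max_right _ _).trans hle)⟩,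
    (le_max_left _ _).trans hle, hzc⟩

theorem CardLT.insert {t : Set Ordinal.{0}} {κ : Cardinal.{0}} (hκ : Cardinal.aleph0 ≤ κ)
    (ht : CardLT t κ) (a : Ordinal.{0}) : CardLT (insert a t) κ :=
  Cardinal.mk_insert_le.trans_lt (Cardinal.add_lt_of_lt (Cardinal.aleph0_le_lift.2 hκ) ht
    (Cardinal.one_lt_aleph0.trans_le (Cardinal.aleph0_le_lift.2 hκ)))

theorem exists_far_of_disjoint {c : Cardinal.{0}} (hc : c.IsRegular)
    {t : Ordinal.{0} → Set Ordinal.{0}}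
    (ht : ∀ a b, a < c.ord → b < c.ord → a ≠ b → Disjoint (t a) (t b)) {δ : Ordinal.{0}}
    (hδ : δ < c.ord) : ∃ a, δ ≤ a ∧ a < c.ord ∧ ∀ ζ ∈ t a, δ < ζ := by
  have h : ∀ x, ∃ b < c.ord, ∀ a < c.ord, x ∈ t a → a ≤ b := by
    intro x
    by_cases hx : ∃ b < c.ord, x ∈ t b
    · obtain ⟨b, hb, hxb⟩ := hx
      refine ⟨b, hb, fun a ha hxa => ?_⟩
      by_contra hab
      exact Set.disjoint_left.1 (ht a b ha hb fun h => hab h.le) hxa hxb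
    · exact ⟨0, hc.ord_pos, fun a ha hxa => absurd ⟨a, ha, hxa⟩ hx⟩
  choose b hb hba using h
  obtain ⟨B, hB, hbB⟩ := exists_bound_Iio hc
    ((Cardinal.isSuccLimit_ord hc.aleph0_le).succ_lt hδ) (fun x _ => hb x)
  refine ⟨max δ B, le_max_left _ _, max_lt hδ hB, fun ζ hζ => ?_⟩
  by_contra hle
  have := hba ζ _ (max_lt hδ hB) hζ
  exact absurd ((le_max_right _ _).trans this)
    (not_le.2 (hbB ζ (Order.lt_succ_iff.2 (not_lt.1 hle))))

/-- If some scale `(mus, f)` for the singular cardinal `μ` satisfies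
`μ_i ↛ [(μ_i : μ_i)]²_{μ_i}` for every `i < cf μ`, then `pr₁(μ⁺,μ⁺,μ⁺,cf μ)` holds. -/
theorem stmt6 (mu : Cardinal) (hsing : IsSingular mu)
    (h : ∃ mus f, IsScale mu mus f ∧ ∀ i, i < cofOrd mu → SquareBrColon (mus i)) :
    Pr1 mu (Order.succ mu) := by
  obtain ⟨mus, f, hs, hsq⟩ := h
  have hmu := hsing.1
  have hκ : mu.ord.cof.IsRegular :=
    Cardinal.isRegular_cof (Cardinal.isSuccLimit_ord hmu)
  have hc : (Order.succ mu).IsRegular := Cardinal.isRegular_succ hmu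
  have hκmus : ∀ i < cofOrd mu, mu.ord.cof < mus i := fun i hi => hs.cof_lt_mus hi
  have hKL : cofOrd mu < sucOrd mu :=
    Cardinal.ord_lt_ord.2 (hsing.2.trans (Order.lt_succ mu))
  obtain ⟨H, hH⟩ := exists_hullSystem hmu hκ hκmus hs.regular (fun i hi => hs.mus_lt hκ hi)
    (fun i j hij hj => hs.mono hij hj) hs.unbdd
  obtain ⟨g, hg, hgx⟩ := exists_enumeration_Iic hmu
  obtain ⟨p, q, hpq⟩ := exists_decoding hκ
  choose! d _ hd using hsq
  refine ⟨hullColor H f g p q d (cofOrd mu),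
    fun a b _ hb => (hullColor_le hg hH.le).trans_lt hb, fun t hsub hdisj hcard ε hε => ?_⟩
  have hfar : ∀ δ < sucOrd mu, ∃ a, δ ≤ a ∧ a < sucOrd mu ∧ ∀ ζ ∈ t a, δ < ζ :=
    fun δ hδ => exists_far_of_disjoint hc hdisj hδ
  have hgap := fun η0 (hη0 : η0 < sucOrd mu) =>
    hH.exists_isGap hmu hκ hsing.2 hs.regular hκmus hsub hcard hfar hη0
  obtain ⟨i0, hi0, hgap0⟩ := hgap 0 hc.ord_pos
  choose! η hη hS using hgap0
  have hηbdd : ∃ η0 < sucOrd mu, ∀ i, i0 ≤ i → i < cofOrd mu → η i < η0 := by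
    obtain ⟨B, hB, h⟩ := exists_bound_of_regular hc (S := {i | i0 ≤ i ∧ i < cofOrd mu}) (h := η)
      ((Cardinal.mk_le_mk_of_subset (t := Set.Iio (cofOrd mu)) fun i hi => hi.2).trans_lt (by
        rw [Cardinal.mk_Iio_ordinal]
        exact Cardinal.lift_lt.2 (Cardinal.lt_ord.1 hKL))) (fun i hi => hη i hi.1 hi.2)
    exact ⟨B, hB, fun i h1 h2 => h i ⟨h1, h2⟩⟩
  obtain ⟨η0, hη0, hηη0⟩ := hηbdd
  obtain ⟨i1, hi1, hgap1⟩ := hgap η0 hη0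
  set i := max i0 i1
  have hi : i < cofOrd mu := max_lt hi0 hi1
  obtain ⟨η1, hη1, hT⟩ := hgap1 i (le_max_right _ _) hi
  have hSi := (hS i (le_max_left _ _) hi).inter_Ioi hc.aleph0_le (max_lt hη1 hη0)
  have hTi := hT.inter_Ioi hc.aleph0_le hε
  set S := {α | ∃ a, α ≤ a ∧ a < sucOrd mu ∧ IsGap H i 0 (η i) α (t a)} ∩ Set.Ioi (max η1 η0)
  set T := {β | ∃ a, β ≤ a ∧ a < sucOrd mu ∧ IsGap H i η0 η1 β (t a)} ∩ Set.Ioi ε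
  obtain ⟨ς, hς, hTς⟩ := exists_fixed_of_unbounded hc
    (Cardinal.ord_lt_ord.2 (Order.lt_succ mu)) (Z := T) (P := fun β ν => g β ν = ε) (by
      intro x hx
      obtain ⟨β, hβ, hxβ, hβL⟩ := hTi x hx
      exact ⟨β, ⟨hβ, hgx β hβL ε (le_of_lt hβ.2)⟩, hxβ, hβL⟩)
  obtain ⟨k1, hk1, hςk⟩ := hs.unbdd _ (Cardinal.lt_ord.1 hς)
  obtain ⟨k2, hk2, hV⟩ := hs.exists_unbounded_value hκ hmu hSi
  obtain ⟨k3, hk3, hW⟩ := hs.exists_unbounded_value hκ hmu hTς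
  set k := max k1 (max k2 k3)
  have hk : k < cofOrd mu := max_lt hk1 (max_lt hk2 hk3)
  have hk1' : k1 ≤ k := le_max_left _ _
  have hk2' : k2 ≤ k := (le_max_left _ _).trans (le_max_right _ _)
  have hk3' : k3 ≤ k := (le_max_right _ _).trans (le_max_right _ _)
  have hIio : ∀ {Z : Set Ordinal.{0}} {o : Ordinal.{0}}, UnbddIn Z o →
      UnbddIn (Z ∩ Set.Iio o) o := by
    intro Z o h x hx
    obtain ⟨y, hy, hxy, hyo⟩ := h x hx
    exact ⟨y, ⟨hy, hyo⟩, hxy, hyo⟩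
  obtain ⟨v, hv, w, hw, -, hdvw⟩ := hd k hk _ _ Set.inter_subset_right Set.inter_subset_right
    (hIio (hV k hk2' hk)) (hIio (hW k hk3' hk)) ς
    (Cardinal.lt_ord.2 (hςk.trans_le (hs.mono hk1' hk)))
  have hX : UnbddIn {z ∈ S | f z k = v} (sucOrd mu) := hv.1
  have hY : UnbddIn {z ∈ {y ∈ T | g y ς = ε} | f z k = w} (sucOrd mu) := hw.1
  have hSa : ∀ α ∈ S, ∃ a, α ≤ a ∧ a < sucOrd mu ∧ IsGap H i 0 (η i) α (t a) :=
    fun α hα => hα.1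
  have hTa : ∀ β ∈ T, ∃ a, β ≤ a ∧ a < sucOrd mu ∧ IsGap H i η0 η1 β (t a) :=
    fun β hβ => hβ.1
  choose! a hαa haL hgapa using hSa
  choose! b hβb hbL hgapb using hTa
  obtain ⟨j0, hj0, hlast⟩ := hs.exists_isLastIndex hκ hmu hX hY
    (s := fun α => insert (a α) (t (a α))) (t := fun β => insert β (t (b β)))
    (by
      rintro α ⟨hα, -⟩ _ ξ (rfl | hξ)
      · exact ⟨hαa α hα, haL α hα⟩
      · exact ⟨((hgapa α hα).lt ξ hξ).le, hsub _ (haL α hα) hξ⟩)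
    (fun α hα _ => (hcard _ (haL α hα.1)).insert hκ.aleph0_le _)
    (by
      rintro β ⟨⟨hβ, -⟩, -⟩ hβL ζ (rfl | hζ)
      · exact ⟨le_rfl, hβL⟩
      · exact ⟨((hgapb β hβ).lt ζ hζ).le, hsub _ (hbL β hβ) hζ⟩)
    (fun β hβ _ => (hcard _ (hbL β hβ.1.1)).insert hκ.aleph0_le _)
  obtain ⟨j, hj0j, hj, hpj, hqj⟩ := hpq i hi k hk j0 hj0
  obtain ⟨α, ⟨hα, hfα⟩, -, β, ⟨⟨hβ, hgβ⟩, hfβ⟩, -, hαβ⟩ := hlast j hj0j hj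
  refine ⟨a α, b β, ?_, hbL β hβ, fun ξ hξ ζ hζ => ?_⟩
  · exact (hs.lt_of_isLastIndex hκ (hαβ _ (Set.mem_insert _ _) _ (Set.mem_insert _ _)) hj
      (haL α hα)).trans_le (hβb β hβ)
  · have hξL : ξ < sucOrd mu := hsub _ (haL α hα) hξ
    have hξβ : ξ < β := hs.lt_of_isLastIndex hκ
      (hαβ ξ (Set.mem_insert_of_mem _ hξ) β (Set.mem_insert _ _)) hj hξL
    have hξζ : ξ < ζ := hξβ.trans ((hgapb β hβ).lt ζ hζ)
    have hα2 := max_lt_iff.1 (Set.mem_Ioi.1 hα.2)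
    rw [min_eq_left hξζ.le, max_eq_right hξζ.le,
      hullColor_eq (K := cofOrd mu) hj
        (hαβ ξ (Set.mem_insert_of_mem _ hξ) ζ (Set.mem_insert_of_mem _ hζ)) hpj (hgapa α hα)
        (hgapb β hβ) hξ hζ (hηη0 i (le_max_left _ _) hi).le hα2.2 hα2.1 hξβ,
      hqj, hfα, hfβ, hdvw, hgβ]

end
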